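/- Let D be the unique derivation on the field ℂ(t) of rational functions extending the formal derivative of polynomials. Then there is no rational function f ∈ ℂ(t) satisfying D⁵f − 20·t·D³f − 30·D²f + 64·t²·Df + 64·t·f = 12. (This is the computational core of the proof that the Painlevé II equation y'' = xy + 2y³, i.e. P_II with parameter a = 0, is irreducible.) -/

import Mathlib

open Polynomial in
/-- The polynomial part of the argument: the fourth symmetric power of the Airy operator raises
the degree of a nonzero polynomial by one, so it never takes a nonzero constant value. -/
theorem airySymmFour_polynomial_ne (p : ℂ[X]) :
    derivative (derivative (derivative (derivative (derivative p))))
      - C 20 * (X * derivative (derivative (derivative p)))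
      - C 30 * derivative (derivative p)
      + C 64 * (X * (X * derivative p)) + C 64 * (X * p) ≠ C 12 := by
  intro h
  have hX : (X * derivative p).coeff p.natDegree = p.natDegree * p.leadingCoeff := by
    rw [leadingCoeff]
    rcases p.natDegree with _ | d
    · simp
    · rw [coeff_X_mul, coeff_derivative]
      push_cast
      ring
  have hz : ∀ k, p.natDegree < k → p.coeff k = 0 := fun k hk =>
    coeff_eq_zero_of_natDegree_lt hk
  have hc := congrArg (fun q => q.coeff (p.natDegree + 1)) h
  simp only [coeff_add, coeff_sub, coeff_C_mul, coeff_X_mul, hX] at hc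
  simp only [coeff_derivative, coeff_C_succ] at hc
  rw [hz _ (by omega), hz _ (by omega), coeff_natDegree] at hc
  have hp : p.leadingCoeff = 0 := by
    have hd : ((p.natDegree : ℂ) + 1) ≠ 0 := Nat.cast_add_one_ne_zero _
    have : ((p.natDegree : ℂ) + 1) * p.leadingCoeff = 0 := by
      linear_combination hc / 64
    exact (mul_eq_zero.mp this).resolve_left hd
  rw [leadingCoeff_eq_zero] at hp
  subst hp
  have := congrArg (fun q => q.coeff 0) h
  simp at this

open Polynomial in
/-- `f` has a pole of order exactly `m` at `a` (for `m = 0`: `f` is regular and nonzero at `a`). -/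
def RatFunc.HasPoleOfOrder (a : ℂ) (m : ℕ) (f : RatFunc ℂ) : Prop :=
  ∃ N q : ℂ[X], N.eval a ≠ 0 ∧ q.eval a ≠ 0 ∧
    f * algebraMap ℂ[X] (RatFunc ℂ) ((Polynomial.X - Polynomial.C a) ^ m * q) = algebraMap ℂ[X] (RatFunc ℂ) N

open Polynomial in
/-- Differentiation raises the order of a pole by one. -/
theorem RatFunc.HasPoleOfOrder.derivation {D : Derivation ℂ (RatFunc ℂ) (RatFunc ℂ)}
    (hD : ∀ p : ℂ[X], D (algebraMap ℂ[X] (RatFunc ℂ) p) =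
      algebraMap ℂ[X] (RatFunc ℂ) (derivative p))
    {a : ℂ} {m : ℕ} {f : RatFunc ℂ} (h : f.HasPoleOfOrder a (m + 1)) :
    (D f).HasPoleOfOrder a (m + 2) := by
  obtain ⟨N, q, hN, hq, hf⟩ := h
  refine ⟨derivative N * (Polynomial.X - Polynomial.C a) * q
    - N * (Polynomial.C ((m : ℂ) + 1) * q + (Polynomial.X - Polynomial.C a) * derivative q), q ^ 2, ?_, ?_, ?_⟩
  · have hm : ((m : ℂ) + 1) ≠ 0 := Nat.cast_add_one_ne_zero _
    simp [hN, hq, hm]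
  · simpa using hq
  · have hd := congrArg D hf
    rw [Derivation.leibniz, hD, hD, derivative_mul, derivative_X_sub_C_pow] at hd
    simp only [smul_eq_mul, Nat.add_sub_cancel, map_mul, map_add, map_pow, map_sub,
      Nat.cast_add, Nat.cast_one, map_natCast, map_one] at hd hf ⊢
    set L := algebraMap ℂ[X] (RatFunc ℂ) Polynomial.X - algebraMap ℂ[X] (RatFunc ℂ) (Polynomial.C a)
    set Q := algebraMap ℂ[X] (RatFunc ℂ) q
    set Q' := algebraMap ℂ[X] (RatFunc ℂ) (derivative q)
    linear_combination L * Q * hd - (((m : RatFunc ℂ) + 1) * Q + L * Q') * hf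

open Polynomial in
/-- A solution of the inhomogeneous equation has no pole. -/
theorem RatFunc.HasPoleOfOrder.airySymmFour_ne {D : Derivation ℂ (RatFunc ℂ) (RatFunc ℂ)}
    (hD : ∀ p : ℂ[X], D (algebraMap ℂ[X] (RatFunc ℂ) p) =
      algebraMap ℂ[X] (RatFunc ℂ) (derivative p))
    {a : ℂ} {m : ℕ} {f : RatFunc ℂ} (h : f.HasPoleOfOrder a (m + 1)) :
    D (D (D (D (D f)))) - 20 * RatFunc.X * D (D (D f)) - 30 * D (D f)
      + 64 * RatFunc.X ^ 2 * D f + 64 * RatFunc.X * f ≠ 12 := by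
  intro heq
  have h₁ := h.derivation hD
  have h₂ := h₁.derivation hD
  have h₃ := h₂.derivation hD
  have h₅ := (h₃.derivation hD).derivation hD
  obtain ⟨N₀, q₀, -, hq₀, e₀⟩ := h
  obtain ⟨N₁, q₁, -, hq₁, e₁⟩ := h₁
  obtain ⟨N₂, q₂, -, hq₂, e₂⟩ := h₂
  obtain ⟨N₃, q₃, -, hq₃, e₃⟩ := h₃
  obtain ⟨N₅, q₅, hN₅, -, e₅⟩ := h₅
  have key : N₅ * (q₀ * q₁ * q₂ * q₃) = (Polynomial.X - Polynomial.C a) * (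
      20 * Polynomial.X * (Polynomial.X - Polynomial.C a) * N₃ * (q₀ * q₁ * q₂ * q₅)
      + 30 * (Polynomial.X - Polynomial.C a) ^ 2 * N₂ * (q₀ * q₁ * q₃ * q₅)
      - 64 * Polynomial.X ^ 2 * (Polynomial.X - Polynomial.C a) ^ 3 * N₁ * (q₀ * q₂ * q₃ * q₅)
      - 64 * Polynomial.X * (Polynomial.X - Polynomial.C a) ^ 4 * N₀ * (q₁ * q₂ * q₃ * q₅)
      + 12 * (Polynomial.X - Polynomial.C a) ^ (m + 5) * (q₀ * q₁ * q₂ * q₃ * q₅)) := by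
    apply RatFunc.algebraMap_injective ℂ
    simp only [map_mul, map_add, map_pow, map_sub, map_ofNat, RatFunc.algebraMap_X,
      ← e₀, ← e₁, ← e₂, ← e₃, ← e₅]
    set L := RatFunc.X - algebraMap ℂ[X] (RatFunc ℂ) (Polynomial.C a)
    linear_combination L ^ (m + 6) * algebraMap ℂ[X] (RatFunc ℂ) q₀
      * algebraMap ℂ[X] (RatFunc ℂ) q₁ * algebraMap ℂ[X] (RatFunc ℂ) q₂
      * algebraMap ℂ[X] (RatFunc ℂ) q₃ * algebraMap ℂ[X] (RatFunc ℂ) q₅ * heq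
  have hev := congrArg (Polynomial.eval a) key
  simp [hN₅, hq₀, hq₁, hq₂, hq₃] at hev

open Polynomial in
/-- A rational function over `ℂ` without poles is a polynomial. -/
theorem RatFunc.exists_hasPoleOfOrder_or_eq_algebraMap (f : RatFunc ℂ) :
    (∃ a m, f.HasPoleOfOrder a (m + 1)) ∨ ∃ p : ℂ[X], f = algebraMap ℂ[X] (RatFunc ℂ) p := by
  have hf : f * algebraMap ℂ[X] (RatFunc ℂ) f.denom = algebraMap ℂ[X] (RatFunc ℂ) f.num := by
    rw [← eq_div_iff (RatFunc.algebraMap_ne_zero f.denom_ne_zero), RatFunc.num_div_denom]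
  by_cases hdeg : f.denom.degree = 0
  · right
    refine ⟨f.num, ?_⟩
    have h1 : f.denom = 1 := f.monic_denom.degree_le_zero_iff_eq_one.mp hdeg.le
    simpa [h1] using hf
  · left
    obtain ⟨a, ha⟩ := IsAlgClosed.exists_root f.denom hdeg
    have hpos := (rootMultiplicity_pos f.denom_ne_zero).mpr ha
    obtain ⟨q, hq, hdvd⟩ := exists_eq_pow_rootMultiplicity_mul_and_not_dvd f.denom f.denom_ne_zero a
    obtain ⟨m, hm⟩ := Nat.exists_eq_succ_of_ne_zero hpos.ne'
    refine ⟨a, m, f.num, q, ?_, ?_, ?_⟩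
    · intro h0
      obtain ⟨u, v, huv⟩ := f.isCoprime_num_denom
      have := congrArg (Polynomial.eval a) huv
      simp [h0, IsRoot.def.mp ha] at this
    · rwa [dvd_iff_isRoot] at hdvd
    · rw [← hf, ← Nat.succ_eq_add_one, ← hm, ← hq]

/-- No rational function `f ∈ ℂ(t)` satisfies
`D⁵f − 20tD³f − 30D²f + 64t²Df + 64tf = 12`, where `D` is the unique derivation of `ℂ(t)`
extending the formal derivative of polynomials. -/
theorem stmt_9 (D : Derivation ℂ (RatFunc ℂ) (RatFunc ℂ))
    (hD : ∀ p : Polynomial ℂ,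
      D (algebraMap (Polynomial ℂ) (RatFunc ℂ) p) =
        algebraMap (Polynomial ℂ) (RatFunc ℂ) (Polynomial.derivative p)) :
    ¬ ∃ f : RatFunc ℂ,
      D (D (D (D (D f)))) - 20 * RatFunc.X * D (D (D f)) - 30 * D (D f)
          + 64 * RatFunc.X ^ 2 * D f + 64 * RatFunc.X * f = 12 := by
  rintro ⟨f, hf⟩
  rcases f.exists_hasPoleOfOrder_or_eq_algebraMap with ⟨a, m, h⟩ | ⟨p, rfl⟩
  · exact h.airySymmFour_ne hD hf
  · apply airySymmFour_polynomial_ne p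
    apply RatFunc.algebraMap_injective ℂ
    simp only [hD] at hf
    simp only [map_mul, map_add, map_sub, map_ofNat, RatFunc.algebraMap_X]
    linear_combination hf
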